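/- Let 0 < p ≤ 1, let N, m be positive integers, let 𝒜 : M_N → ℝ^m be a linear map, and for a positive integer k let α_k, β_k be the best constants with α_k ‖Z‖_{S_2} ≤ ‖𝒜Z‖_{ℓ2} ≤ β_k ‖Z‖_{S_2} for all Z ∈ M_N of rank at most k; assume α_{2t} > 0 and set γ_{2t} = β_{2t}^2/α_{2t}^2. If for some integers t ≥ s ≥ 1 one has γ_{2t} − 1 < 4(√2 − 1)(t/s)^{1/p − 1/2}, then for every X ∈ M_N with rank(X) ≤ s, every minimizer X* of ‖Z‖_{S_p} over all Z ∈ M_N with 𝒜Z = 𝒜X equals X; that is, every matrix of rank at most s is exactly recovered by Schatten p-quasi-norm minimization. -/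

import Mathlib

noncomputable def singVals {N : ℕ} (X : Matrix (Fin N) (Fin N) ℝ) : Fin N → ℝ :=
  fun i => Real.sqrt ((Matrix.isHermitian_conjTranspose_mul_self X).eigenvalues i)

/-- The Schatten `p`-quasi-norm of a real `N × N` matrix. -/
noncomputable def schattenNorm {N : ℕ} (p : ℝ) (X : Matrix (Fin N) (Fin N) ℝ) : ℝ :=
  (∑ i, singVals X i ^ p) ^ (1 / p)

open scoped RealInnerProductSpace

/-- Increments of a concave power are largest near the origin. -/
theorem rpow_add_sub_rpow_le {p L m d : ℝ} (hp0 : 0 ≤ p) (hp1 : p ≤ 1) (hL : 0 ≤ L) (hLm : L ≤ m)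
    (hd : 0 ≤ d) : (m + d) ^ p - m ^ p ≤ (L + d) ^ p - L ^ p := by
  rcases hd.eq_or_lt with rfl | hd'
  · simp
  have hc := Real.concaveOn_rpow hp0 hp1
  have hD : 0 < m + d - L := by linarith
  set D := m + d - L with hDdef
  have hsum1 : d / D + (m - L) / D = 1 := by rw [← add_div, div_eq_one_iff_eq hD.ne']; ring
  have hmL : 0 ≤ (m - L) / D := div_nonneg (by linarith) hD.le
  have hdD : 0 ≤ d / D := div_nonneg hd hD.le
  have h1 := hc.2 (Set.mem_Ici.2 hL) (Set.mem_Ici.2 (by linarith : 0 ≤ m + d)) hdD hmL hsum1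
  have h2 := hc.2 (Set.mem_Ici.2 hL) (Set.mem_Ici.2 (by linarith : 0 ≤ m + d)) hmL hdD
    (by rw [add_comm]; exact hsum1)
  have e1 : d / D * L + (m - L) / D * (m + d) = m := by field_simp; rw [hDdef]; ring
  have e2 : (m - L) / D * L + d / D * (m + d) = L + d := by field_simp; rw [hDdef]; ring
  simp only [smul_eq_mul] at h1 h2
  rw [e1] at h1
  rw [e2] at h2
  have e3 : d / D * L ^ p + (m - L) / D * (m + d) ^ p + ((m - L) / D * L ^ p + d / D * (m + d) ^ p)
      = L ^ p + (m + d) ^ p := by linear_combination (L ^ p + (m + d) ^ p) * hsum1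
  linarith

/-- For interlacing sequences the total length of the gaps is at most the largest term. -/
theorem sum_gap_le_of_interlacing {n : ℕ} (M m : Fin n → ℝ) (hm : ∀ i, 0 ≤ m i)
    (hint : ∀ i j, i < j → M j ≤ m i) {C : ℝ} (hC : 0 ≤ C) (hMC : ∀ i, M i ≤ C) :
    ∑ i, (M i - m i) ≤ C := by
  induction n generalizing C with
  | zero => simpa
  | succ n ih =>
    rw [Fin.sum_univ_succ]
    have := ih (fun i => M i.succ) (fun i => m i.succ) (fun i => hm _)
      (fun i j hij => hint _ _ (Fin.succ_lt_succ_iff.2 hij)) (hm 0)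
      (fun i => hint _ _ (Fin.succ_pos i))
    linarith [hMC 0]

theorem sum_rpow_gap_le_of_interlacing {n : ℕ} {p : ℝ} (hp0 : 0 < p) (hp1 : p ≤ 1)
    (M m : Fin n → ℝ) (hm : ∀ i, 0 ≤ m i) (hmM : ∀ i, m i ≤ M i)
    (hint : ∀ i j, i < j → M j ≤ m i) :
    ∑ i, (M i ^ p - m i ^ p) ≤ (∑ i, (M i - m i)) ^ p := by
  induction n with
  | zero => simp [hp0.ne']
  | succ n ih =>
    rw [Fin.sum_univ_succ, Fin.sum_univ_succ]
    have h := ih (fun i => M i.succ) (fun i => m i.succ) (fun i => hm _) (fun i => hmM _)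
      (fun i j hij => hint _ _ (Fin.succ_lt_succ_iff.2 hij))
    have hL := sum_gap_le_of_interlacing (fun i => M i.succ) (fun i => m i.succ) (fun i => hm _)
      (fun i j hij => hint _ _ (Fin.succ_lt_succ_iff.2 hij)) (hm 0)
      (fun i => hint _ _ (Fin.succ_pos i))
    have hL0 : 0 ≤ ∑ i : Fin n, (M i.succ - m i.succ) :=
      Finset.sum_nonneg fun i _ => sub_nonneg.2 (hmM _)
    have h3 := rpow_add_sub_rpow_le hp0.le hp1 hL0 hL (sub_nonneg.2 (hmM 0))
    rw [add_sub_cancel] at h3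
    rw [add_comm (M 0 - m 0)]
    linarith

section Spectral

variable {V : Type*} [NormedAddCommGroup V] [InnerProductSpace ℝ V] {n : ℕ}

/-- The quadratic form `q` is diagonal in the orthonormal basis `b`, with decreasing
coefficients `a`. -/
structure IsDiagonalizedBy (q : V → ℝ) (a : Fin n → ℝ) (b : OrthonormalBasis (Fin n) ℝ V) :
    Prop where
  antitone : Antitone a
  eq_sum : ∀ x, q x = ∑ i, a i * ⟪b i, x⟫ ^ 2

theorem OrthonormalBasis.inner_eq_zero_of_mem_span (b : OrthonormalBasis (Fin n) ℝ V)
    {s : Set (Fin n)} {x : V} (hx : x ∈ Submodule.span ℝ (b '' s)) {j : Fin n} (hj : j ∉ s) :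
    ⟪b j, x⟫ = 0 := by
  induction hx using Submodule.span_induction with
  | mem x h =>
    obtain ⟨i, hi, rfl⟩ := h
    exact b.orthonormal.2 (by rintro rfl; exact hj hi)
  | zero => simp
  | add x y _ _ hx hy => rw [inner_add_right, hx, hy, add_zero]
  | smul c x _ hx => rw [inner_smul_right, hx, mul_zero]

theorem OrthonormalBasis.finrank_span_image (b : OrthonormalBasis (Fin n) ℝ V)
    (s : Finset (Fin n)) : Module.finrank ℝ (Submodule.span ℝ (b '' s)) = s.card := by
  have := finrank_span_eq_card (R := ℝ) (b := fun i : s => b i)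
    (b.orthonormal.linearIndependent.comp _ Subtype.val_injective)
  rw [Fintype.card_coe] at this
  rw [← this, Set.image_eq_range]
  rfl

/-- Weyl's inequality: domination of quadratic forms on a subspace of codimension `k`
shifts the eigenvalues by at most `k` places. -/
theorem IsDiagonalizedBy.le_of_le_on {q q' : V → ℝ} {a a' : Fin n → ℝ}
    {b b' : OrthonormalBasis (Fin n) ℝ V} (h : IsDiagonalizedBy q a b)
    (h' : IsDiagonalizedBy q' a' b') (W : Submodule ℝ V) (k : ℕ)
    (hW : n ≤ Module.finrank ℝ W + k) (hle : ∀ x ∈ W, q' x ≤ q x) {i j : Fin n}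
    (hij : (i : ℕ) + k ≤ j) : a' j ≤ a i := by
  have : FiniteDimensional ℝ V := b.toBasis.finiteDimensional_of_finite
  have hn : Module.finrank ℝ V = n := by simpa using Module.finrank_eq_card_basis b.toBasis
  set U := Submodule.span ℝ (b '' (Finset.Ici i : Finset (Fin n)))
  set U' := Submodule.span ℝ (b' '' (Finset.Iic j : Finset (Fin n)))
  have hU : Module.finrank ℝ U = n - i := by rw [b.finrank_span_image]; simp
  have hU' : Module.finrank ℝ U' = j + 1 := by rw [b'.finrank_span_image]; simp
  have e1 := Submodule.finrank_sup_add_finrank_inf_eq U U'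
  have e2 := Submodule.finrank_sup_add_finrank_inf_eq (U ⊓ U') W
  have l1 := Submodule.finrank_le (U ⊔ U')
  have l2 := Submodule.finrank_le (U ⊓ U' ⊔ W)
  have hpos : 0 < Module.finrank ℝ (U ⊓ U' ⊓ W : Submodule ℝ V) := by
    have := i.2
    have := j.2
    omega
  obtain ⟨x, hx, hx0⟩ := Submodule.exists_mem_ne_zero_of_ne_bot
    (Submodule.one_le_finrank_iff.1 hpos)
  obtain ⟨⟨hxU, hxU'⟩, hxW⟩ := hx
  have hq : q x ≤ a i * ‖x‖ ^ 2 := by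
    rw [h.eq_sum, ← b.sum_sq_inner_right, Finset.mul_sum]
    refine Finset.sum_le_sum fun l _ => ?_
    by_cases hl : i ≤ l
    · exact mul_le_mul_of_nonneg_right (h.antitone hl) (sq_nonneg _)
    · rw [b.inner_eq_zero_of_mem_span hxU (by simpa using hl)]; simp
  have hq' : a' j * ‖x‖ ^ 2 ≤ q' x := by
    rw [h'.eq_sum, ← b'.sum_sq_inner_right, Finset.mul_sum]
    refine Finset.sum_le_sum fun l _ => ?_
    by_cases hl : l ≤ j
    · exact mul_le_mul_of_nonneg_right (h'.antitone hl) (sq_nonneg _)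
    · rw [b'.inner_eq_zero_of_mem_span hxU' (by simpa using hl)]; simp
  have : 0 < ‖x‖ ^ 2 := by positivity
  exact le_of_mul_le_mul_right (hq'.trans ((hle x hxW).trans hq)) this

/-- A rank-one positive update of a diagonalized quadratic form can be diagonalized, and the
trace grows by `‖w‖ ^ 2`. -/
theorem IsDiagonalizedBy.exists_add_sq_inner {q : V → ℝ} {a : Fin n → ℝ}
    {b : OrthonormalBasis (Fin n) ℝ V} (h : IsDiagonalizedBy q a b) (w : V) :
    ∃ (c : Fin n → ℝ) (d : OrthonormalBasis (Fin n) ℝ V),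
      IsDiagonalizedBy (fun x => q x + ⟪w, x⟫ ^ 2) c d ∧ ∑ i, c i = ∑ i, a i + ‖w‖ ^ 2 := by
  have : FiniteDimensional ℝ V := b.toBasis.finiteDimensional_of_finite
  have hn : Module.finrank ℝ V = n := by simpa using Module.finrank_eq_card_basis b.toBasis
  let T : V →ₗ[ℝ] V := ∑ i, a i • (innerₛₗ ℝ (b i)).smulRight (b i) + (innerₛₗ ℝ w).smulRight w
  have hT : ∀ x y, ⟪T x, y⟫ = ∑ i, a i * (⟪b i, x⟫ * ⟪b i, y⟫) + ⟪w, x⟫ * ⟪w, y⟫ := by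
    intro x y
    simp [T, LinearMap.sum_apply, inner_add_left, sum_inner, inner_smul_left]
  have hsymm : T.IsSymmetric := fun x y => by
    rw [hT, real_inner_comm (T y) x, hT]
    simp only [mul_comm]
  refine ⟨hsymm.eigenvalues hn, hsymm.eigenvectorBasis hn, ?_⟩
  have hd : IsDiagonalizedBy (fun x => q x + ⟪w, x⟫ ^ 2) (hsymm.eigenvalues hn)
      (hsymm.eigenvectorBasis hn) := by
    refine ⟨hsymm.eigenvalues_antitone hn, fun x => ?_⟩
    have h1 : q x + ⟪w, x⟫ ^ 2 = ⟪T x, x⟫ := by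
      rw [hT, h.eq_sum]; simp only [sq]
    rw [h1, ← (hsymm.eigenvectorBasis hn).sum_inner_mul_inner]
    refine Finset.sum_congr rfl fun i _ => ?_
    rw [hsymm x, hsymm.apply_eigenvectorBasis, inner_smul_right, real_inner_comm]
    simp; ring
  refine ⟨hd, ?_⟩
  have h2 : ∑ j, (q (b j) + ⟪w, b j⟫ ^ 2) = ∑ i, hsymm.eigenvalues hn i := by
    simp only [hd.eq_sum]
    rw [Finset.sum_comm]
    refine Finset.sum_congr rfl fun i _ => ?_
    rw [← Finset.mul_sum]
    simp only [real_inner_comm (b _)]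
    simp [b.sum_sq_inner_right]
  rw [← h2, Finset.sum_add_distrib]
  congr 1
  · refine Finset.sum_congr rfl fun j _ => ?_
    rw [h.eq_sum, Finset.sum_eq_single j]
    · simp
    · intro i _ hij; simp [b.orthonormal.2 hij]
    · simp
  · simp only [real_inner_comm (b _), b.sum_sq_inner_right]

theorem IsDiagonalizedBy.interlacing_add_sq_inner {q q' : V → ℝ} {a c : Fin n → ℝ}
    {b d : OrthonormalBasis (Fin n) ℝ V} (h : IsDiagonalizedBy q a b)
    (h' : IsDiagonalizedBy q' c d) (w : V) (hq : ∀ x, q' x = q x + ⟪w, x⟫ ^ 2) :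
    (∀ i, a i ≤ c i) ∧ ∀ i j, i < j → c j ≤ a i := by
  have : FiniteDimensional ℝ V := b.toBasis.finiteDimensional_of_finite
  have hn : Module.finrank ℝ V = n := by simpa using Module.finrank_eq_card_basis b.toBasis
  constructor
  · intro i
    refine h'.le_of_le_on h ⊤ 0 (by simp [hn]) (fun x _ => ?_) le_rfl
    rw [hq]
    linarith [sq_nonneg ⟪w, x⟫]
  · intro i j hij
    refine h.le_of_le_on h' (ℝ ∙ w)ᗮ 1 ?_ (fun x hx => ?_) hij
    · have h1 := Submodule.finrank_add_finrank_orthogonal (ℝ ∙ w)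
      have h2 : Module.finrank ℝ (ℝ ∙ w) ≤ 1 := by
        simpa using finrank_span_le_card (R := ℝ) ({w} : Set V)
      omega
    · rw [hq, Submodule.mem_orthogonal_singleton_iff_inner_right.1 hx]
      simp

end Spectral

section SingularValues

variable {E : Type*} [NormedAddCommGroup E] [InnerProductSpace ℝ E] {n : ℕ}

/-- A singular value decomposition of `F` with decreasing singular values `σ`. -/
structure IsSVD (F : E →ₗ[ℝ] E) (σ : Fin n → ℝ) (u v : OrthonormalBasis (Fin n) ℝ E) :
    Prop where
  antitone : Antitone σ
  nonneg : ∀ i, 0 ≤ σ i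
  apply_eq : ∀ i, F (v i) = σ i • u i

theorem IsSVD.apply_eq_sum {F : E →ₗ[ℝ] E} {σ : Fin n → ℝ} {u v : OrthonormalBasis (Fin n) ℝ E}
    (h : IsSVD F σ u v) (y : E) : F y = ∑ i, (σ i * ⟪v i, y⟫) • u i := by
  conv_lhs => rw [← v.sum_repr' y, map_sum]
  refine Finset.sum_congr rfl fun i _ => ?_
  rw [map_smul, h.apply_eq, smul_smul, mul_comm]

theorem IsSVD.neg {F : E →ₗ[ℝ] E} {σ : Fin n → ℝ} {u v : OrthonormalBasis (Fin n) ℝ E}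
    (h : IsSVD F σ u v) : IsSVD (-F) σ (u.map (LinearIsometryEquiv.neg ℝ)) v :=
  ⟨h.antitone, h.nonneg, fun i => by simp [h.apply_eq]⟩

/-- The quadratic form of the self-adjoint dilation of `F` has eigenvalues `± σ i`. -/
theorem IsSVD.exists_dilation {F : E →ₗ[ℝ] E} {σ : Fin n → ℝ}
    {u v : OrthonormalBasis (Fin n) ℝ E} (h : IsSVD F σ u v) :
    ∃ b, IsDiagonalizedBy (fun z : WithLp 2 (E × E) => 2 * ⟪F z.snd, z.fst⟫)
      (Fin.append σ fun i => -σ i.rev) b := by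
  have : FiniteDimensional ℝ E := u.toBasis.finiteDimensional_of_finite
  have hn : Module.finrank ℝ E = n := by simpa using Module.finrank_eq_card_basis u.toBasis
  obtain ⟨r, hr⟩ : ∃ r : ℝ, r * r = 1 / 2 := ⟨√(1 / 2), Real.mul_self_sqrt (by norm_num)⟩
  let f : Fin (n + n) → WithLp 2 (E × E) :=
    Fin.append (fun i => WithLp.toLp 2 (r • u i, r • v i))
      (fun i => WithLp.toLp 2 (r • u i.rev, -(r • v i.rev)))
  have hf : Orthonormal ℝ f := by
    rw [orthonormal_iff_ite]
    intro i j
    have hu := orthonormal_iff_ite.1 u.orthonormal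
    have hv := orthonormal_iff_ite.1 v.orthonormal
    refine Fin.addCases (fun i => ?_) (fun i => ?_) i <;>
      refine Fin.addCases (fun j => ?_) (fun j => ?_) j <;>
      simp only [f, Fin.append_left, Fin.append_right, WithLp.prod_inner_apply, inner_smul_left,
        inner_smul_right, inner_neg_left, inner_neg_right, hu, hv] <;>
      simp [Fin.ext_iff] <;> (try split_ifs) <;> first | omega | linarith
  obtain ⟨b, hb⟩ := Orthonormal.exists_orthonormalBasis_extension_of_card_eq
    (ι := Fin (n + n)) (v := f) (s := Set.univ) (𝕜 := ℝ)
    (by rw [(WithLp.linearEquiv 2 ℝ (E × E)).finrank_eq]; simp [hn])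
    (hf.comp _ Subtype.val_injective)
  refine ⟨b, ?_, fun z => ?_⟩
  · intro i j hij
    induction i using Fin.addCases with
    | left i =>
      induction j using Fin.addCases with
      | left j =>
        simp only [Fin.append_left]
        exact h.antitone hij
      | right j =>
        simp only [Fin.append_left, Fin.append_right]
        exact (neg_nonpos.2 (h.nonneg _)).trans (h.nonneg _)
    | right i =>
      induction j using Fin.addCases with
      | left j =>
        exfalso
        simp [Fin.le_def] at hij
        omega
      | right j =>
        simp only [Fin.append_right]
        exact neg_le_neg (h.antitone (Fin.rev_le_rev.2 (by simpa using hij)))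
  · have hb' : ∀ i, b i = f i := fun i => hb i trivial
    simp only [hb', f]
    rw [Fin.sum_univ_add]
    simp only [Fin.append_left, Fin.append_right]
    rw [← Equiv.sum_comp Fin.revPerm, ← Finset.sum_add_distrib, h.apply_eq_sum, sum_inner,
      Finset.mul_sum]
    rw [← Equiv.sum_comp Fin.revPerm]
    refine Finset.sum_congr rfl fun i _ => ?_
    simp only [WithLp.prod_inner_apply, inner_smul_left, inner_neg_left, Fin.revPerm_apply]
    simp
    generalize ⟪u _, z.fst⟫ = x
    generalize ⟪v _, z.snd⟫ = y
    linear_combination (-4 * σ i.rev * x * y) * hr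

/-- Interlacing and perturbation bounds for singular values under a rank-one update. -/
theorem IsSVD.rank_one_update {F F' : E →ₗ[ℝ] E} {σ σ' : Fin n → ℝ}
    {u v u' v' : OrthonormalBasis (Fin n) ℝ E} (h : IsSVD F σ u v) (h' : IsSVD F' σ' u' v')
    {a b : E} {τ : ℝ} (hτ : 0 ≤ τ) (ha : ‖a‖ = 1) (hb : ‖b‖ = 1)
    (hF : ∀ y, F' y = F y + (τ * ⟪a, y⟫) • b) :
    (∀ i j, i < j → σ' j ≤ σ i) ∧ (∀ i j, i < j → σ j ≤ σ' i) ∧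
      ∑ i, |σ i - σ' i| ≤ τ := by
  obtain ⟨d, hd⟩ := h.exists_dilation
  obtain ⟨d', hd'⟩ := h'.exists_dilation
  set r := √(τ / 2) with hr
  have hrr : r * r = τ / 2 := Real.mul_self_sqrt (by linarith)
  set w : WithLp 2 (E × E) := WithLp.toLp 2 (r • b, r • a) with hw
  set w' : WithLp 2 (E × E) := WithLp.toLp 2 (r • b, -(r • a)) with hw'
  obtain ⟨μ, e, hμ, hsum⟩ := hd.exists_add_sq_inner w
  obtain ⟨l1, l2⟩ := hd.interlacing_add_sq_inner hμ w (fun x => rfl)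
  obtain ⟨l1', l2'⟩ := hd'.interlacing_add_sq_inner hμ w' (fun x => by
    simp only [hF, hw, hw', WithLp.prod_inner_apply, inner_add_left, inner_smul_left,
      inner_neg_left]
    simp
    linear_combination (4 * ⟪b, x.fst⟫ * ⟪a, x.snd⟫) * hrr)
  have hnorm : ‖w‖ ^ 2 = τ := by
    rw [← real_inner_self_eq_norm_sq, hw, WithLp.prod_inner_apply]
    simp only [inner_smul_left, inner_smul_right, real_inner_self_eq_norm_sq, ha, hb]
    simp
    linarith
  have htr : ∀ ρ : Fin n → ℝ, ∑ i, Fin.append ρ (fun i => -ρ i.rev) i = 0 := by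
    intro ρ
    rw [Fin.sum_univ_add]
    simp only [Fin.append_left, Fin.append_right, Finset.sum_neg_distrib]
    rw [← Equiv.sum_comp Fin.revPerm ρ]
    simp
  refine ⟨fun i j hij => ?_, fun i j hij => ?_, ?_⟩
  · simpa using (l1' (Fin.castAdd n j)).trans (l2 (Fin.castAdd n i) _ hij)
  · simpa using (l1 (Fin.castAdd n j)).trans (l2' (Fin.castAdd n i) _ hij)
  · have key : ∑ i, |Fin.append σ (fun i => -σ i.rev) i - Fin.append σ' (fun i => -σ' i.rev) i|
        ≤ 2 * τ := by
      calc _ ≤ ∑ i, ((μ i - Fin.append σ (fun i => -σ i.rev) i)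
            + (μ i - Fin.append σ' (fun i => -σ' i.rev) i)) := by
            refine Finset.sum_le_sum fun i _ => ?_
            rw [abs_le]
            constructor <;> linarith [l1 i, l1' i]
        _ = 2 * τ := by
            rw [Finset.sum_add_distrib, Finset.sum_sub_distrib, Finset.sum_sub_distrib, htr, htr,
              hsum, htr, hnorm]
            ring
    rw [Fin.sum_univ_add] at key
    simp only [Fin.append_left, Fin.append_right] at key
    rw [← Equiv.sum_comp Fin.revPerm (fun i : Fin n => |-σ i.rev - -σ' i.rev|)] at key
    have : ∀ i : Fin n, |-σ i - -σ' i| = |σ i - σ' i| := fun i => by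
      rw [← abs_neg]; ring_nf
    simp only [Fin.revPerm_apply, Fin.rev_rev, this] at key
    linarith

theorem IsSVD.sum_abs_rpow_sub_le_of_rank_one_update {F F' : E →ₗ[ℝ] E} {σ σ' : Fin n → ℝ}
    {u v u' v' : OrthonormalBasis (Fin n) ℝ E} (h : IsSVD F σ u v) (h' : IsSVD F' σ' u' v')
    {p : ℝ} (hp0 : 0 < p) (hp1 : p ≤ 1)
    {a b : E} {τ : ℝ} (hτ : 0 ≤ τ) (ha : ‖a‖ = 1) (hb : ‖b‖ = 1)
    (hF : ∀ y, F' y = F y + (τ * ⟪a, y⟫) • b) :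
    ∑ i, |σ i ^ p - σ' i ^ p| ≤ τ ^ p := by
  obtain ⟨h1, h2, h3⟩ := h.rank_one_update h' hτ ha hb hF
  have key := sum_rpow_gap_le_of_interlacing hp0 hp1 (fun i => max (σ i) (σ' i))
    (fun i => min (σ i) (σ' i)) (fun i => le_min (h.nonneg i) (h'.nonneg i))
    (fun i => min_le_max) (fun i j hij => max_le
      (le_min (h.antitone hij.le) (h2 i j hij)) (le_min (h1 i j hij) (h'.antitone hij.le)))
  simp only [max_sub_min_eq_abs'] at key
  calc _ = ∑ i, (max (σ i) (σ' i) ^ p - min (σ i) (σ' i) ^ p) := by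
        refine Finset.sum_congr rfl fun i _ => ?_
        rcases le_total (σ i) (σ' i) with hle | hle
        · have := Real.rpow_le_rpow (h.nonneg i) hle hp0.le
          rw [max_eq_right hle, min_eq_left hle, abs_of_nonpos (by linarith), neg_sub]
        · have := Real.rpow_le_rpow (h'.nonneg i) hle hp0.le
          rw [max_eq_left hle, min_eq_right hle, abs_of_nonneg (by linarith)]
    _ ≤ _ := key
    _ ≤ τ ^ p := Real.rpow_le_rpow (Finset.sum_nonneg fun i _ => abs_nonneg _) h3 hp0.le

theorem exists_perm_isSVD (F : E →ₗ[ℝ] E) (w : OrthonormalBasis (Fin n) ℝ E) (τ : Fin n → ℝ)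
    (hτ : ∀ i, 0 ≤ τ i) (hF : ∀ i j, ⟪F (w i), F (w j)⟫ = if i = j then τ i ^ 2 else 0) :
    ∃ (e : Equiv.Perm (Fin n)) (u v : OrthonormalBasis (Fin n) ℝ E), IsSVD F (τ ∘ e) u v := by
  have : FiniteDimensional ℝ E := w.toBasis.finiteDimensional_of_finite
  have hn : Module.finrank ℝ E = n := by simpa using Module.finrank_eq_card_basis w.toBasis
  have hu : Orthonormal ℝ ({i | τ i ≠ 0}.domRestrict fun i => (τ i)⁻¹ • F (w i)) := by
    rw [orthonormal_iff_ite]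
    rintro ⟨i, hi⟩ ⟨j, hj⟩
    simp only [Set.domRestrict_apply, inner_smul_left, inner_smul_right, hF, Subtype.mk.injEq]
    split_ifs with hij
    · subst hij
      have : τ i ≠ 0 := hi
      simp
      field_simp
    · simp
  obtain ⟨b, hb⟩ := hu.exists_orthonormalBasis_extension_of_card_eq (by simp [hn])
  let e := Tuple.sort fun i => -τ i
  refine ⟨e, b.reindex e.symm, w.reindex e.symm, ?_, fun i => hτ _, fun i => ?_⟩
  · intro i j hij
    have := Tuple.monotone_sort (fun i => -τ i) hij
    simpa using this
  · simp only [OrthonormalBasis.reindex_apply, Equiv.symm_symm, Function.comp]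
    by_cases h0 : τ (e i) = 0
    · rw [h0, zero_smul, ← inner_self_eq_zero (𝕜 := ℝ), hF, if_pos rfl, h0]
      simp
    · rw [hb _ h0, smul_smul, mul_inv_cancel₀ h0, one_smul]

end SingularValues

section SparseVectors

variable {G : Type*} [NormedAddCommGroup G] [InnerProductSpace ℝ G]

/-- Restricted near-isometry on two pieces makes the pieces nearly orthogonal. -/
theorem neg_inner_le_of_near_isometry {A B l r : ℝ} {x y : G} (hl : 0 ≤ l) (hr : 0 ≤ r)
    (hlow : ∀ a b : ℝ, A * (a ^ 2 * l ^ 2 + b ^ 2 * r ^ 2) ≤ ‖a • x + b • y‖ ^ 2)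
    (hupp : ∀ a b : ℝ, ‖a • x + b • y‖ ^ 2 ≤ B * (a ^ 2 * l ^ 2 + b ^ 2 * r ^ 2)) :
    -⟪x, y⟫ ≤ (B - A) / 2 * (l * r) := by
  have hexp : ∀ a b : ℝ, ‖a • x + b • y‖ ^ 2
      = a ^ 2 * ‖x‖ ^ 2 + 2 * (a * b * ⟪x, y⟫) + b ^ 2 * ‖y‖ ^ 2 := by
    intro a b
    rw [norm_add_sq_real, norm_smul, norm_smul, mul_pow, mul_pow, inner_smul_left,
      inner_smul_right]
    simp
    ring
  simp only [hexp] at hlow hupp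
  rcases hl.eq_or_lt with rfl | hl
  · have h1 := hupp 1 0
    have : ‖x‖ = 0 := by
      have := sq_nonneg ‖x‖
      exact pow_eq_zero_iff two_ne_zero |>.1 (by nlinarith)
    rw [norm_eq_zero] at this
    simp [this]
  rcases hr.eq_or_lt with rfl | hr
  · have h1 := hupp 0 1
    have : ‖y‖ = 0 := by
      have := sq_nonneg ‖y‖
      exact pow_eq_zero_iff two_ne_zero |>.1 (by nlinarith)
    rw [norm_eq_zero] at this
    simp [this]
  have h1 := hlow r l
  have h2 := hupp r (-l)
  have hlr : 0 < l * r := mul_pos hl hr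
  have : (l * r) * (-⟪x, y⟫) ≤ (l * r) * ((B - A) / 2 * (l * r)) := by nlinarith
  exact le_of_mul_le_mul_left this hlr

theorem le_of_near_isometry_of_sum_eq_zero {α β γ : ℝ} (hα : 0 < α) (hγ0 : 0 ≤ γ)
    (hγ : β ^ 2 / α ^ 2 - 1 ≤ γ) (x : ℕ → G) (l : ℕ → ℝ) (hl : ∀ k, 0 ≤ l k)
    (hlow : ∀ j k, j ≠ k → ∀ a b : ℝ,
      α ^ 2 * (a ^ 2 * l j ^ 2 + b ^ 2 * l k ^ 2) ≤ ‖a • x j + b • x k‖ ^ 2)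
    (hupp : ∀ j k, j ≠ k → ∀ a b : ℝ,
      ‖a • x j + b • x k‖ ^ 2 ≤ β ^ 2 * (a ^ 2 * l j ^ 2 + b ^ 2 * l k ^ 2))
    (K : ℕ) (hsum : ∑ k ∈ Finset.range (K + 2), x k = 0) :
    l 0 ≤ (1 + √2) / 4 * γ * ∑ k ∈ Finset.range K, l (k + 2) := by
  set S := ∑ k ∈ Finset.range K, l (k + 2) with hS
  have hS0 : 0 ≤ S := Finset.sum_nonneg fun k _ => hl _
  have hβγ : β ^ 2 - α ^ 2 ≤ γ * α ^ 2 := by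
    have : 0 < α ^ 2 := by positivity
    rw [sub_le_iff_le_add, div_le_iff₀ this] at hγ
    linarith
  have hx : x 0 + x 1 = -∑ k ∈ Finset.range K, x (k + 2) := by
    rw [Finset.sum_range_succ', Finset.sum_range_succ'] at hsum
    rw [eq_neg_iff_add_eq_zero, ← hsum]
    simp only [zero_add]
    abel
  have h1 : ‖x 0 + x 1‖ ^ 2 ≤ (β ^ 2 - α ^ 2) / 2 * ((l 0 + l 1) * S) := by
    rw [← real_inner_self_eq_norm_sq]
    nth_rw 2 [hx]
    rw [inner_neg_right, inner_sum, ← Finset.sum_neg_distrib, hS, Finset.mul_sum, Finset.mul_sum]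
    refine Finset.sum_le_sum fun k _ => ?_
    have e0 := neg_inner_le_of_near_isometry (hl 0) (hl (k + 2)) (hlow 0 (k + 2) (by omega))
      (hupp 0 (k + 2) (by omega))
    have e1 := neg_inner_le_of_near_isometry (hl 1) (hl (k + 2)) (hlow 1 (k + 2) (by omega))
      (hupp 1 (k + 2) (by omega))
    rw [inner_add_left]
    linarith
  have h2 := hlow 0 1 (by omega) 1 1
  simp only [one_smul, one_pow, one_mul] at h2
  have hls : 0 ≤ (l 0 + l 1) * S := mul_nonneg (add_nonneg (hl 0) (hl 1)) hS0
  have h3 : α ^ 2 * (l 0 ^ 2 + l 1 ^ 2) ≤ α ^ 2 * (γ / 2 * ((l 0 + l 1) * S)) := by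
    nlinarith [mul_le_mul_of_nonneg_right hβγ hls]
  have h4 := le_of_mul_le_mul_left h3 (by positivity)
  have hA : 0 ≤ γ * S / 4 := by positivity
  have h5 : (l 0 - γ * S / 4) ^ 2 ≤ (√2 * (γ * S / 4)) ^ 2 := by
    rw [mul_pow, Real.sq_sqrt (by norm_num)]
    nlinarith [sq_nonneg (l 1 - γ * S / 4)]
  have h6 := (abs_le_of_sq_le_sq' h5 (by positivity)).2
  linarith

theorem sum_rpow_rpow_inv_le {ι : Type*} (I : Finset ι) (g : ι → ℝ) (hg : ∀ i, 0 ≤ g i) {p : ℝ}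
    (hp0 : 0 < p) (hp1 : p ≤ 1) :
    (∑ i ∈ I, g i ^ p) ^ (1 / p) ≤ (I.card : ℝ) ^ (1 / p - 1 / 2) * √(∑ i ∈ I, g i ^ 2) := by
  have hS : 0 ≤ ∑ i ∈ I, g i ^ p := Finset.sum_nonneg fun i _ => Real.rpow_nonneg (hg i) p
  rw [← sq_le_sq₀ (by positivity) (by positivity), mul_pow,
    Real.sq_sqrt (Finset.sum_nonneg fun i _ => sq_nonneg _)]
  have h := Real.rpow_sum_le_const_mul_sum_rpow_of_nonneg (s := I) (f := fun i => g i ^ p)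
    (p := 2 / p) (by rw [le_div_iff₀ hp0]; linarith) (fun i _ => Real.rpow_nonneg (hg i) p)
  have e1 : ((∑ i ∈ I, g i ^ p) ^ (1 / p)) ^ 2 = (∑ i ∈ I, g i ^ p) ^ (2 / p) := by
    rw [← Real.rpow_natCast, ← Real.rpow_mul hS]
    congr 1
    push_cast
    ring
  have e2 : ((I.card : ℝ) ^ (1 / p - 1 / 2)) ^ 2 = (I.card : ℝ) ^ (2 / p - 1) := by
    rw [← Real.rpow_natCast, ← Real.rpow_mul (by positivity)]
    congr 1
    push_cast
    ring
  have e3 : ∀ i, (g i ^ p) ^ (2 / p) = g i ^ 2 := fun i => by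
    rw [← Real.rpow_mul (hg i), mul_div_cancel₀ _ hp0.ne', Real.rpow_two]
  simpa only [e1, e2, e3] using h

/-- If every entry of `g` on `J` is dominated by every entry on `I`, then the `ℓ²` norm on `J`
is controlled by the `ℓᵖ` quasi-norm on `I`. -/
theorem sqrt_sum_sq_le_of_dominated {ι : Type*} (I J : Finset ι) (g : ι → ℝ) (hg : ∀ i, 0 ≤ g i)
    {p : ℝ} (hp0 : 0 < p) {t : ℕ} (ht : 0 < t) (hI : I.card = t) (hJ : J.card = t)
    (hIJ : ∀ i ∈ I, ∀ j ∈ J, g j ≤ g i) :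
    √(∑ j ∈ J, g j ^ 2) ≤ (t : ℝ) ^ (1 / 2 - 1 / p) * (∑ i ∈ I, g i ^ p) ^ (1 / p) := by
  have hS : 0 ≤ ∑ i ∈ I, g i ^ p := Finset.sum_nonneg fun i _ => Real.rpow_nonneg (hg i) p
  set S := ∑ i ∈ I, g i ^ p with hSdef
  have ht' : (0 : ℝ) < t := by exact_mod_cast ht
  have hj : ∀ j ∈ J, g j ≤ (S / t) ^ (1 / p) := by
    intro j hj
    have : g j ^ p ≤ S / t := by
      rw [le_div_iff₀ ht', mul_comm, ← hI, ← nsmul_eq_mul]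
      exact Finset.card_nsmul_le_sum _ _ _ fun i hi =>
        Real.rpow_le_rpow (hg j) (hIJ i hi j hj) hp0.le
    calc g j = (g j ^ p) ^ (1 / p) := by
          rw [← Real.rpow_mul (hg j), mul_one_div_cancel hp0.ne', Real.rpow_one]
      _ ≤ _ := Real.rpow_le_rpow (Real.rpow_nonneg (hg j) p) this (by positivity)
  have hsum : ∑ j ∈ J, g j ^ 2 ≤ t * ((S / t) ^ (1 / p)) ^ 2 := by
    rw [← hJ, ← nsmul_eq_mul]
    exact Finset.sum_le_card_nsmul _ _ _ fun j hjJ => by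
      rw [hJ]
      exact pow_le_pow_left₀ (hg j) (hj j hjJ) 2
  refine (Real.sqrt_le_sqrt hsum).trans_eq ?_
  rw [Real.sqrt_mul ht'.le, Real.sqrt_sq (by positivity), Real.div_rpow hS ht'.le,
    Real.sqrt_eq_rpow, Real.rpow_sub ht']
  ring

theorem sum_rpow_le_rpow_sum {ι : Type*} (I : Finset ι) (f : ι → ℝ) (hf : ∀ i, 0 ≤ f i) {r : ℝ}
    (hr : 1 ≤ r) : ∑ i ∈ I, f i ^ r ≤ (∑ i ∈ I, f i) ^ r := by
  classical
  induction I using Finset.induction_on with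
  | empty => simp [Real.zero_rpow (by linarith : r ≠ 0)]
  | insert a I ha ih =>
    rw [Finset.sum_insert ha, Finset.sum_insert ha]
    exact (add_le_add_right ih _).trans
      (Real.add_rpow_le_rpow_add (hf a) (Finset.sum_nonneg fun i _ => hf i) hr)

/-- Endpoints of the blocks of lengths `s, t, t, …`. -/
def blockStart (s t : ℕ) : ℕ → ℕ
  | 0 => 0
  | k + 1 => s + k * t

/-- The consecutive blocks of lengths `s, t, t, …`. -/
def block (s t k : ℕ) : Finset ℕ :=
  Finset.Ico (blockStart s t k) (blockStart s t (k + 1))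

theorem blockStart_mono (s t : ℕ) : Monotone (blockStart s t) := by
  refine monotone_nat_of_le_succ fun k => ?_
  cases k with
  | zero => simp [blockStart]
  | succ k => simp only [blockStart]; nlinarith

theorem card_block_zero (s t : ℕ) : (block s t 0).card = s := by simp [block, blockStart]

theorem card_block_succ (s t k : ℕ) : (block s t (k + 1)).card = t := by
  simp only [block, blockStart, Nat.card_Ico]
  have : (k + 1) * t = k * t + t := by ring
  omega

theorem disjoint_block {s t j k : ℕ} (h : j ≠ k) : Disjoint (block s t j) (block s t k) := by
  wlog hjk : j < k generalizing j k
  · exact (this h.symm (by omega)).symm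
  rw [block, block, Finset.disjoint_left]
  intro i hi hi'
  rw [Finset.mem_Ico] at hi hi'
  have := blockStart_mono s t (show j + 1 ≤ k by omega)
  omega

theorem sum_block {M : Type*} [AddCommMonoid M] (s t K : ℕ) (f : ℕ → M) (j : ℕ) :
    ∑ k ∈ Finset.range K, ∑ i ∈ block s t (j + k), f i
      = ∑ i ∈ Finset.Ico (blockStart s t j) (blockStart s t (j + K)), f i := by
  induction K with
  | zero => simp
  | succ K ih =>
    rw [Finset.sum_range_succ, ih, block, Finset.sum_Ico_consecutive _
      (blockStart_mono s t (by omega)) (blockStart_mono s t (by omega))]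
    rfl

/-- The null space property forces a decreasing vector in the kernel of a map with a suitable
restricted near-isometry property to vanish. -/
theorem eq_zero_of_restricted_near_isometry {N s t : ℕ} (hs : 0 < s) (hst : s ≤ t) {p α β : ℝ}
    (hp0 : 0 < p) (hp1 : p ≤ 1) (hα : 0 < α) (L : (ℕ → ℝ) →ₗ[ℝ] G)
    (hlow : ∀ (c : ℕ → ℝ) (I : Finset ℕ), I.card ≤ 2 * t → (∀ i ∉ I, c i = 0) →
      (∀ i, N ≤ i → c i = 0) → α ^ 2 * ∑ i ∈ I, c i ^ 2 ≤ ‖L c‖ ^ 2)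
    (hupp : ∀ (c : ℕ → ℝ) (I : Finset ℕ), I.card ≤ 2 * t → (∀ i ∉ I, c i = 0) →
      (∀ i, N ≤ i → c i = 0) → ‖L c‖ ^ 2 ≤ β ^ 2 * ∑ i ∈ I, c i ^ 2)
    (hγ : β ^ 2 / α ^ 2 - 1 < 4 * (√2 - 1) * ((t : ℝ) / s) ^ (1 / p - 1 / 2))
    (g : ℕ → ℝ) (hg : ∀ i, 0 ≤ g i) (hanti : Antitone g) (hgN : ∀ i, N ≤ i → g i = 0)
    (hLg : L g = 0)
    (hnull : ∑ i ∈ Finset.Ico s (s + N * t), g i ^ p ≤ ∑ i ∈ Finset.range s, g i ^ p) (i : ℕ) :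
    g i = 0 := by
  have hs' : (0 : ℝ) < s := by exact_mod_cast hs
  have ht : 0 < t := by omega
  have ht' : (0 : ℝ) < t := by exact_mod_cast ht
  set y : ℕ → ℕ → ℝ := fun k i => if i ∈ block s t k then g i else 0 with hy
  set l : ℕ → ℝ := fun k => √(∑ i ∈ block s t k, g i ^ 2) with hldef
  have hl : ∀ k, 0 ≤ l k := fun k => Real.sqrt_nonneg _
  have hlsq : ∀ k, l k ^ 2 = ∑ i ∈ block s t k, g i ^ 2 := fun k =>
    Real.sq_sqrt (Finset.sum_nonneg fun i _ => sq_nonneg _)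
  have hcard : ∀ k, (block s t k).card ≤ t := by
    intro k
    cases k with
    | zero => rw [card_block_zero]; exact hst
    | succ k => rw [card_block_succ]
  have hpair : ∀ j k, j ≠ k → ∀ a b : ℝ,
      (block s t j ∪ block s t k).card ≤ 2 * t ∧
      (∀ i ∉ block s t j ∪ block s t k, (a • y j + b • y k) i = 0) ∧
      (∀ i, N ≤ i → (a • y j + b • y k) i = 0) ∧
      ∑ i ∈ block s t j ∪ block s t k, (a • y j + b • y k) i ^ 2
        = a ^ 2 * l j ^ 2 + b ^ 2 * l k ^ 2 := by
    intro j k hjk a b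
    have hdisj := disjoint_block (s := s) (t := t) hjk
    refine ⟨(Finset.card_union_le _ _).trans (by linarith [hcard j, hcard k]), ?_, ?_, ?_⟩
    · intro i hi
      simp only [Finset.mem_union, not_or] at hi
      simp [hy, hi.1, hi.2]
    · intro i hi
      simp [hy, hgN i hi]
    · rw [Finset.sum_union hdisj, hlsq, hlsq, Finset.mul_sum, Finset.mul_sum]
      congr 1
      · refine Finset.sum_congr rfl fun i hi => ?_
        simp [hy, hi, Finset.disjoint_left.1 hdisj hi, mul_pow]
      · refine Finset.sum_congr rfl fun i hi => ?_
        simp [hy, hi, Finset.disjoint_right.1 hdisj hi, mul_pow]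
  have hysum : ∑ k ∈ Finset.range (N + 2), y k = g := by
    ext i
    have h1 := sum_block s t (N + 2) (fun j => if i = j then g j else 0) 0
    simp only [Finset.sum_ite_eq, zero_add] at h1
    rw [Finset.sum_apply]
    simp only [hy]
    rw [h1]
    split_ifs with hi
    · rfl
    · refine (hgN i ?_).symm
      simp only [blockStart, Finset.mem_Ico, not_and, not_lt] at hi
      have := hi (Nat.zero_le _)
      nlinarith
  set γ := max (β ^ 2 / α ^ 2 - 1) 0 with hγdef
  have hmain := le_of_near_isometry_of_sum_eq_zero hα (le_max_right _ _ : 0 ≤ γ) (le_max_left _ _)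
    (fun k => L (y k)) l hl
    (fun j k hjk a b => by
      obtain ⟨h1, h2, h3, h4⟩ := hpair j k hjk a b
      simpa only [h4, map_add, map_smul] using hlow _ _ h1 h2 h3)
    (fun j k hjk a b => by
      obtain ⟨h1, h2, h3, h4⟩ := hpair j k hjk a b
      simpa only [h4, map_add, map_smul] using hupp _ _ h1 h2 h3)
    N (by rw [← map_sum, hysum, hLg])
  set T := ∑ i ∈ Finset.Ico s (s + N * t), g i ^ p with hT
  set S := ∑ i ∈ Finset.range s, g i ^ p with hSdef
  have hgp : ∀ i, 0 ≤ g i ^ p := fun i => Real.rpow_nonneg (hg i) p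
  have hT0 : 0 ≤ T := Finset.sum_nonneg fun i _ => hgp i
  have hp1' : 1 ≤ 1 / p := by rw [le_div_iff₀ hp0]; linarith
  have htail : ∑ k ∈ Finset.range N, l (k + 2) ≤ (t : ℝ) ^ (1 / 2 - 1 / p) * T ^ (1 / p) := by
    calc _ ≤ ∑ k ∈ Finset.range N, (t : ℝ) ^ (1 / 2 - 1 / p)
            * (∑ i ∈ block s t (1 + k), g i ^ p) ^ (1 / p) := by
          refine Finset.sum_le_sum fun k _ => ?_
          rw [add_comm 1 k]
          refine sqrt_sum_sq_le_of_dominated _ _ g hg hp0 ht (card_block_succ s t k)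
            (card_block_succ s t (k + 1)) fun i hi j hj => hanti ?_
          exact (Finset.mem_Ico.1 hi).2.le.trans (Finset.mem_Ico.1 hj).1
      _ ≤ _ := by
          rw [← Finset.mul_sum]
          refine mul_le_mul_of_nonneg_left ?_ (by positivity)
          refine (sum_rpow_le_rpow_sum _ _ (fun k => Finset.sum_nonneg fun i _ => hgp i)
            hp1').trans_eq ?_
          rw [sum_block, add_comm 1 N]
          simp [blockStart, hT]
  have hhead : S ^ (1 / p) ≤ (s : ℝ) ^ (1 / p - 1 / 2) * l 0 := by
    have := sum_rpow_rpow_inv_le (block s t 0) g hg hp0 hp1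
    rw [card_block_zero] at this
    simpa [hldef, block, blockStart, hSdef] using this
  have h2 : 1 < √2 := by rw [Real.lt_sqrt] <;> norm_num
  have hratio : 0 < ((t : ℝ) / s) ^ (1 / p - 1 / 2) := by positivity
  have hκ : (1 + √2) / 4 * γ < ((t : ℝ) / s) ^ (1 / p - 1 / 2) := by
    have hγlt : γ < 4 * (√2 - 1) * ((t : ℝ) / s) ^ (1 / p - 1 / 2) :=
      max_lt hγ (by have : 0 < √2 - 1 := by linarith
                    positivity)
    have hsq : √2 * √2 = 2 := Real.mul_self_sqrt (by norm_num)
    calc _ < (1 + √2) / 4 * (4 * (√2 - 1) * ((t : ℝ) / s) ^ (1 / p - 1 / 2)) :=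
          mul_lt_mul_of_pos_left hγlt (by positivity)
      _ = _ := by linear_combination ((t : ℝ) / s) ^ (1 / p - 1 / 2) * hsq
  have hκ' : (s : ℝ) ^ (1 / p - 1 / 2) * ((1 + √2) / 4 * γ * (t : ℝ) ^ (1 / 2 - 1 / p)) < 1 := by
    have e : (t : ℝ) ^ (1 / 2 - 1 / p) = ((t : ℝ) ^ (1 / p - 1 / 2))⁻¹ := by
      rw [← Real.rpow_neg ht'.le]; ring_nf
    rw [Real.div_rpow ht'.le hs'.le, lt_div_iff₀ (by positivity)] at hκ
    rw [e, ← div_eq_mul_inv, ← mul_div_assoc, div_lt_one (by positivity)]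
    linarith
  have hγ0 : 0 ≤ γ := le_max_right _ _
  have hST : S ^ (1 / p) ≤ (s : ℝ) ^ (1 / p - 1 / 2)
      * ((1 + √2) / 4 * γ * (t : ℝ) ^ (1 / 2 - 1 / p)) * T ^ (1 / p) := by
    calc _ ≤ _ := hhead
      _ ≤ (s : ℝ) ^ (1 / p - 1 / 2) * ((1 + √2) / 4 * γ
            * ((t : ℝ) ^ (1 / 2 - 1 / p) * T ^ (1 / p))) := by
          refine mul_le_mul_of_nonneg_left (hmain.trans ?_) (by positivity)
          exact mul_le_mul_of_nonneg_left htail (by positivity)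
      _ = _ := by ring
  have hTS : T ^ (1 / p) ≤ S ^ (1 / p) := Real.rpow_le_rpow hT0 hnull (by positivity)
  have hTp : T ^ (1 / p) = 0 := by
    have h0 : 0 ≤ T ^ (1 / p) := Real.rpow_nonneg hT0 _
    by_contra hne
    have := mul_lt_mul_of_pos_right hκ' (lt_of_le_of_ne h0 (Ne.symm hne))
    linarith
  rw [hTp, mul_zero] at hST
  have hS0 : 0 ≤ S := hT0.trans hnull
  have hS : S = 0 := by
    by_contra hne
    have : 0 < S ^ (1 / p) := Real.rpow_pos_of_pos (lt_of_le_of_ne hS0 (Ne.symm hne)) _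
    linarith
  have hg0 : g 0 ^ p = 0 :=
    (Finset.sum_eq_zero_iff_of_nonneg fun i _ => hgp i).1 hS 0 (Finset.mem_range.2 hs)
  rw [Real.rpow_eq_zero (hg 0) hp0.ne'] at hg0
  exact le_antisymm ((hanti (Nat.zero_le i)).trans_eq hg0) (hg i)

end SparseVectors

section MatrixSVD

variable {N : ℕ}

theorem IsSVD.sum_norm_sq_apply {E : Type*} [NormedAddCommGroup E] [InnerProductSpace ℝ E]
    {F : E →ₗ[ℝ] E} {σ : Fin N → ℝ} {u v : OrthonormalBasis (Fin N) ℝ E} (h : IsSVD F σ u v)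
    (b : OrthonormalBasis (Fin N) ℝ E) : ∑ i, ‖F (b i)‖ ^ 2 = ∑ i, σ i ^ 2 := by
  have h1 : ∀ y j, ⟪u j, F y⟫ = σ j * ⟪v j, y⟫ := by
    intro y j
    rw [h.apply_eq_sum, inner_sum, Finset.sum_eq_single j]
    · simp [inner_smul_right]
    · intro i _ hij
      rw [inner_smul_right, u.orthonormal.2 hij.symm, mul_zero]
    · simp
  simp only [← u.sum_sq_inner_right, h1, mul_pow]
  rw [Finset.sum_comm]
  refine Finset.sum_congr rfl fun j _ => ?_
  rw [← Finset.mul_sum]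
  simp only [real_inner_comm (b _)]
  simp [b.sum_sq_inner_right]

theorem exists_perm_isSVD_toEuclideanLin (X : Matrix (Fin N) (Fin N) ℝ) :
    ∃ (e : Equiv.Perm (Fin N)) (u v : OrthonormalBasis (Fin N) ℝ (EuclideanSpace ℝ (Fin N))),
      IsSVD (Matrix.toEuclideanLin X) (singVals X ∘ e) u v := by
  set hX := Matrix.isHermitian_conjTranspose_mul_self X
  refine exists_perm_isSVD _ hX.eigenvectorBasis _ (fun i => Real.sqrt_nonneg _) fun i j => ?_
  have hnn : 0 ≤ hX.eigenvalues i :=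
    (Matrix.posSemidef_conjTranspose_mul_self X).eigenvalues_nonneg i
  have h1 : (Matrix.toEuclideanLin X).adjoint (Matrix.toEuclideanLin X (hX.eigenvectorBasis j))
      = hX.eigenvalues j • hX.eigenvectorBasis j := by
    rw [← Matrix.toEuclideanLin_conjTranspose_eq_adjoint]
    ext k
    have := congrFun (hX.mulVec_eigenvectorBasis j) k
    rw [← Matrix.mulVec_mulVec] at this
    exact this
  rw [← LinearMap.adjoint_inner_right, h1, inner_smul_right,
    orthonormal_iff_ite.1 hX.eigenvectorBasis.orthonormal]
  split_ifs with hij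
  · subst hij
    rw [mul_one, singVals, Real.sq_sqrt hnn]
  · simp

theorem exists_isSVD (F : EuclideanSpace ℝ (Fin N) →ₗ[ℝ] EuclideanSpace ℝ (Fin N)) :
    ∃ (σ : Fin N → ℝ) (u v : OrthonormalBasis (Fin N) ℝ (EuclideanSpace ℝ (Fin N))),
      IsSVD F σ u v := by
  obtain ⟨e, u, v, h⟩ := exists_perm_isSVD_toEuclideanLin (Matrix.toEuclideanLin.symm F)
  rw [LinearEquiv.apply_symm_apply] at h
  exact ⟨_, u, v, h⟩

/-- The concave Mirsky inequality for powers `0 < p ≤ 1`, with the perturbation given as a sum of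
normalized rank-one operators. -/
theorem IsSVD.sum_abs_rpow_sub_le {F F' : EuclideanSpace ℝ (Fin N) →ₗ[ℝ] EuclideanSpace ℝ (Fin N)}
    {σ σ' : Fin N → ℝ} {u v u' v' : OrthonormalBasis (Fin N) ℝ (EuclideanSpace ℝ (Fin N))}
    (h : IsSVD F σ u v) (h' : IsSVD F' σ' u' v') {p : ℝ} (hp0 : 0 < p) (hp1 : p ≤ 1)
    {ι : Type*} (I : Finset ι) (a b : ι → EuclideanSpace ℝ (Fin N)) (τ : ι → ℝ)
    (hτ : ∀ l, 0 ≤ τ l) (ha : ∀ l, ‖a l‖ = 1) (hb : ∀ l, ‖b l‖ = 1)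
    (hF : ∀ y, F' y = F y + ∑ l ∈ I, (τ l * ⟪a l, y⟫) • b l) :
    ∑ i, |σ i ^ p - σ' i ^ p| ≤ ∑ l ∈ I, τ l ^ p := by
  classical
  induction I using Finset.induction_on generalizing F' σ' u' v' with
  | empty =>
    rcases isEmpty_or_nonempty (Fin N) with hN | ⟨⟨i⟩⟩
    · simp
    have := h.sum_abs_rpow_sub_le_of_rank_one_update h' hp0 hp1 (a := u i) (b := u i) le_rfl
      (by simp) (by simp) (fun y => by simpa using hF y)
    simpa [Real.zero_rpow hp0.ne'] using this
  | insert l I hl ih =>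
    obtain ⟨ρ, u₁, v₁, h₁⟩ :=
      exists_isSVD (F + ∑ l ∈ I, τ l • (innerₛₗ ℝ (a l)).smulRight (b l))
    have e1 := ih h₁ (fun y => by simp [LinearMap.sum_apply, smul_smul])
    have e2 := h₁.sum_abs_rpow_sub_le_of_rank_one_update h' hp0 hp1 (hτ l) (ha l) (hb l)
      (fun y => by
        rw [hF, Finset.sum_insert hl]
        simp only [LinearMap.add_apply, LinearMap.sum_apply, LinearMap.smul_apply,
          LinearMap.smulRight_apply, innerₛₗ_apply_apply, smul_smul]
        abel)
    rw [Finset.sum_insert hl]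
    calc _ ≤ ∑ i, (|σ i ^ p - ρ i ^ p| + |ρ i ^ p - σ' i ^ p|) :=
          Finset.sum_le_sum fun i _ => abs_sub_le _ _ _
      _ ≤ _ := by rw [Finset.sum_add_distrib]; linarith

theorem sum_singVals_rpow_eq {X : Matrix (Fin N) (Fin N) ℝ} (e : Equiv.Perm (Fin N)) (p : ℝ) :
    ∑ i, (singVals X ∘ e) i ^ p = ∑ i, singVals X i ^ p :=
  Equiv.sum_comp e fun i => singVals X i ^ p

theorem schattenNorm_two_sq (Z : Matrix (Fin N) (Fin N) ℝ)
    (b : OrthonormalBasis (Fin N) ℝ (EuclideanSpace ℝ (Fin N))) :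
    schattenNorm 2 Z ^ 2 = ∑ i, ‖Matrix.toEuclideanLin Z (b i)‖ ^ 2 := by
  obtain ⟨e, u, v, h⟩ := exists_perm_isSVD_toEuclideanLin Z
  have h0 : 0 ≤ ∑ i, singVals Z i ^ 2 := Finset.sum_nonneg fun i _ => sq_nonneg _
  rw [h.sum_norm_sq_apply, schattenNorm]
  simp only [Real.rpow_two]
  rw [← Real.sqrt_eq_rpow, Real.sq_sqrt h0]
  exact (Equiv.sum_comp e fun i => singVals Z i ^ 2).symm

theorem schattenNorm_nonneg (p : ℝ) (Z : Matrix (Fin N) (Fin N) ℝ) : 0 ≤ schattenNorm p Z :=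
  Real.rpow_nonneg (Finset.sum_nonneg fun _ _ => Real.rpow_nonneg (Real.sqrt_nonneg _) _) _

theorem rank_eq_finrank_range_toEuclideanLin (X : Matrix (Fin N) (Fin N) ℝ) :
    X.rank = Module.finrank ℝ (LinearMap.range (Matrix.toEuclideanLin X)) := by
  rw [Matrix.toEuclideanLin_eq_toLin_orthonormal]
  exact X.rank_eq_finrank_range_toLin _ _

theorem IsSVD.eq_zero_of_rank_le {X : Matrix (Fin N) (Fin N) ℝ} {σ : Fin N → ℝ}
    {u v : OrthonormalBasis (Fin N) ℝ (EuclideanSpace ℝ (Fin N))}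
    (h : IsSVD (Matrix.toEuclideanLin X) σ u v) {s : ℕ} (hX : X.rank ≤ s) {i : Fin N}
    (hi : s ≤ i) : σ i = 0 := by
  by_contra hne
  have hpos : 0 < σ i := lt_of_le_of_ne (h.nonneg i) (Ne.symm hne)
  have hle : Submodule.span ℝ (u '' (Finset.Iic i : Finset (Fin N)))
      ≤ LinearMap.range (Matrix.toEuclideanLin X) := by
    rw [Submodule.span_le]
    rintro _ ⟨j, hj, rfl⟩
    have hj' : 0 < σ j := hpos.trans_le (h.antitone (by simpa using hj))
    exact ⟨(σ j)⁻¹ • v j, by rw [map_smul, h.apply_eq, smul_smul, inv_mul_cancel₀ hj'.ne', one_smul]⟩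
  have := Submodule.finrank_mono hle
  rw [u.finrank_span_image, ← rank_eq_finrank_range_toEuclideanLin] at this
  simp at this
  omega

/-- The operator `∑ i, c i • u i ⊗ v i`, linear in the coefficients `c`. -/
noncomputable def diagonalOperator (u v : OrthonormalBasis (Fin N) ℝ (EuclideanSpace ℝ (Fin N))) :
    (ℕ → ℝ) →ₗ[ℝ] EuclideanSpace ℝ (Fin N) →ₗ[ℝ] EuclideanSpace ℝ (Fin N) :=
  ∑ i : Fin N, (LinearMap.proj (i : ℕ)).smulRight ((innerₛₗ ℝ (v i)).smulRight (u i))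

theorem diagonalOperator_apply (u v : OrthonormalBasis (Fin N) ℝ (EuclideanSpace ℝ (Fin N)))
    (c : ℕ → ℝ) (y : EuclideanSpace ℝ (Fin N)) :
    diagonalOperator u v c y = ∑ i : Fin N, (c i * ⟪v i, y⟫) • u i := by
  simp [diagonalOperator, LinearMap.sum_apply, smul_smul]

theorem schattenNorm_two_sq_diagonalOperator
    (u v : OrthonormalBasis (Fin N) ℝ (EuclideanSpace ℝ (Fin N))) (c : ℕ → ℝ) :
    schattenNorm 2 (Matrix.toEuclideanLin.symm (diagonalOperator u v c)) ^ 2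
      = ∑ i : Fin N, c i ^ 2 := by
  rw [schattenNorm_two_sq _ v, LinearEquiv.apply_symm_apply]
  refine Finset.sum_congr rfl fun i _ => ?_
  rw [diagonalOperator_apply, Finset.sum_eq_single i]
  · simp [norm_smul]
  · intro j _ hj
    rw [v.orthonormal.2 hj, mul_zero, zero_smul]
  · simp

theorem rank_diagonalOperator_le (u v : OrthonormalBasis (Fin N) ℝ (EuclideanSpace ℝ (Fin N)))
    (c : ℕ → ℝ) (I : Finset ℕ) (hI : ∀ i ∉ I, c i = 0) :
    (Matrix.toEuclideanLin.symm (diagonalOperator u v c)).rank ≤ I.card := by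
  rw [rank_eq_finrank_range_toEuclideanLin, LinearEquiv.apply_symm_apply]
  set J : Finset (Fin N) := Finset.univ.filter fun i => (i : ℕ) ∈ I
  have hle : LinearMap.range (diagonalOperator u v c) ≤ Submodule.span ℝ (u '' J) := by
    rintro _ ⟨y, rfl⟩
    rw [diagonalOperator_apply]
    refine Submodule.sum_mem _ fun i _ => ?_
    by_cases hi : (i : ℕ) ∈ I
    · exact Submodule.smul_mem _ _ (Submodule.subset_span ⟨i, by simpa [J] using hi, rfl⟩)
    · simp [hI _ hi]
  refine (Submodule.finrank_mono hle).trans ?_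
  rw [u.finrank_span_image]
  exact Finset.card_le_card_of_injOn (fun i => (i : ℕ)) (fun i hi => by simpa [J] using hi)
    (Fin.val_injective.injOn)

theorem sum_fin_eq_sum_of_support_subset {M : Type*} [AddCommMonoid M] (f : ℕ → M) (I : Finset ℕ)
    (hI : ∀ i ∉ I, f i = 0) (hN : ∀ i, N ≤ i → f i = 0) :
    ∑ i : Fin N, f i = ∑ i ∈ I, f i := by
  rw [← Finset.sum_range]
  trans ∑ i ∈ Finset.range N ∪ I, f i
  · exact Finset.sum_subset Finset.subset_union_left fun i _ hi => hN i (by simpa using hi)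
  · exact (Finset.sum_subset Finset.subset_union_right fun i _ hi => hI i hi).symm

end MatrixSVD

/-- Exact recovery of rank-`s` matrices via Schatten `p`-quasi-norm minimization under
the condition `γ_{2t} - 1 < 4(√2 - 1)(t/s)^{1/p - 1/2}`. -/
theorem exact_recovery_schatten_p
    (p : ℝ) (hp0 : 0 < p) (hp1 : p ≤ 1)
    (N m s t : ℕ) (hN : 0 < N) (hm : 0 < m) (hs : 0 < s) (hst : s ≤ t)
    (A : Matrix (Fin N) (Fin N) ℝ →ₗ[ℝ] EuclideanSpace ℝ (Fin m))
    (α β : ℝ) (hαpos : 0 < α)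
    -- `α` is the best lower constant for matrices of rank at most `2t`
    (hα : ∀ Z : Matrix (Fin N) (Fin N) ℝ, Z.rank ≤ 2 * t →
      α * schattenNorm 2 Z ≤ ‖A Z‖)
    (hαbest : ∀ a : ℝ, (∀ Z : Matrix (Fin N) (Fin N) ℝ, Z.rank ≤ 2 * t →
      a * schattenNorm 2 Z ≤ ‖A Z‖) → a ≤ α)
    -- `β` is the best upper constant for matrices of rank at most `2t`
    (hβ : ∀ Z : Matrix (Fin N) (Fin N) ℝ, Z.rank ≤ 2 * t →
      ‖A Z‖ ≤ β * schattenNorm 2 Z)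
    (hβbest : ∀ b : ℝ, (∀ Z : Matrix (Fin N) (Fin N) ℝ, Z.rank ≤ 2 * t →
      ‖A Z‖ ≤ b * schattenNorm 2 Z) → β ≤ b)
    (hγcond : β ^ 2 / α ^ 2 - 1 < 4 * (Real.sqrt 2 - 1) * ((t : ℝ) / s) ^ (1 / p - 1 / 2))
    (X : Matrix (Fin N) (Fin N) ℝ) (hrank : X.rank ≤ s)
    (Xstar : Matrix (Fin N) (Fin N) ℝ)
    (hfeas : A Xstar = A X)
    (hmin : ∀ Z : Matrix (Fin N) (Fin N) ℝ, A Z = A X →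
      schattenNorm p Xstar ≤ schattenNorm p Z) :
    Xstar = X := by
  obtain ⟨eX, uX, vX, hX⟩ := exists_perm_isSVD_toEuclideanLin X
  obtain ⟨eB, uB, vB, hB⟩ := exists_perm_isSVD_toEuclideanLin Xstar
  obtain ⟨σ, u, v, hH⟩ := exists_isSVD (Matrix.toEuclideanLin (Xstar - X))
  have hmirsky := hX.neg.sum_abs_rpow_sub_le hH hp0 hp1 Finset.univ vB uB (singVals Xstar ∘ eB)
    hB.nonneg (by simp) (by simp) (fun y => by
      rw [← hB.apply_eq_sum, map_sub, LinearMap.sub_apply, LinearMap.neg_apply]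
      abel)
  have hnorm : ∑ i, singVals Xstar i ^ p ≤ ∑ i, singVals X i ^ p := by
    have h0 : ∀ Z : Matrix (Fin N) (Fin N) ℝ, 0 ≤ ∑ i, singVals Z i ^ p := fun Z =>
      Finset.sum_nonneg fun _ _ => Real.rpow_nonneg (Real.sqrt_nonneg _) _
    exact (Real.rpow_le_rpow_iff (h0 _) (h0 _) (by positivity)).1 (hmin X rfl)
  rw [sum_singVals_rpow_eq] at hmirsky
  replace hmirsky := hmirsky.trans hnorm
  rw [← sum_singVals_rpow_eq eX] at hmirsky
  set g : ℕ → ℝ := fun i => if h : i < N then σ ⟨i, h⟩ else 0 with hg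
  have hgσ : ∀ i : Fin N, g i = σ i := fun i => by simp [hg]
  have hg0 : ∀ i, 0 ≤ g i := fun i => by
    by_cases h : i < N
    · simpa [hg, h] using hH.nonneg _
    · simp [hg, h]
  have hgN : ∀ i, N ≤ i → g i = 0 := fun i hi => by simp [hg, not_lt.2 hi]
  have hanti : Antitone g := fun i j hij => by
    by_cases h : j < N
    · simpa [hg, h, hij.trans_lt h] using hH.antitone (Fin.mk_le_mk.2 hij)
    · rw [hgN j (not_lt.1 h)]
      exact hg0 i
  have hgH : Matrix.toEuclideanLin.symm (diagonalOperator u v g) = Xstar - X := by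
    rw [LinearEquiv.symm_apply_eq]
    ext1 y
    rw [diagonalOperator_apply, hH.apply_eq_sum]
    simp only [hgσ]
  have hnull : ∑ i ∈ Finset.Ico s (s + N * t), g i ^ p ≤ ∑ i ∈ Finset.range s, g i ^ p := by
    set φ : ℕ → ℝ := fun i => if i < s then -g i ^ p else g i ^ p with hφ
    have hφ0 : ∑ i : Fin N, φ i ≤ 0 := by
      have hle : ∀ i : Fin N, (singVals X ∘ eX) i ^ p + φ i
          ≤ |(singVals X ∘ eX) i ^ p - σ i ^ p| := by
        intro i
        by_cases hi : (i : ℕ) < s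
        · simp only [hφ, hi, if_true, hgσ]
          exact le_abs_self _
        · rw [hX.eq_zero_of_rank_le hrank (not_lt.1 hi), Real.zero_rpow hp0.ne']
          simp only [hφ, hi, if_false, hgσ, zero_add, zero_sub, abs_neg]
          exact le_abs_self _
      have := (Finset.sum_le_sum fun i _ => hle i).trans hmirsky
      rw [Finset.sum_add_distrib] at this
      linarith
    have hNt : N ≤ s + N * t := by nlinarith
    have hφN : ∀ i, N ≤ i → φ i = 0 := fun i hi => by
      simp [hφ, hgN i hi, Real.zero_rpow hp0.ne']
    rw [sum_fin_eq_sum_of_support_subset φ (Finset.range (s + N * t))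
      (fun i hi => hφN i (by simp at hi; omega)) hφN,
      ← Finset.sum_range_add_sum_Ico _ (Nat.le_add_right s (N * t))] at hφ0
    have e1 : ∑ i ∈ Finset.range s, φ i = -∑ i ∈ Finset.range s, g i ^ p := by
      rw [← Finset.sum_neg_distrib]
      exact Finset.sum_congr rfl fun i hi => if_pos (Finset.mem_range.1 hi)
    have e2 : ∑ i ∈ Finset.Ico s (s + N * t), φ i = ∑ i ∈ Finset.Ico s (s + N * t), g i ^ p :=
      Finset.sum_congr rfl fun i hi => if_neg (not_lt.2 (Finset.mem_Ico.1 hi).1)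
    linarith
  have hsq : ∀ (c : ℕ → ℝ) (I : Finset ℕ), (∀ i ∉ I, c i = 0) → (∀ i, N ≤ i → c i = 0) →
      schattenNorm 2 (Matrix.toEuclideanLin.symm (diagonalOperator u v c)) ^ 2
        = ∑ i ∈ I, c i ^ 2 := fun c I hI hc => by
    rw [schattenNorm_two_sq_diagonalOperator]
    exact sum_fin_eq_sum_of_support_subset (fun i => c i ^ 2) I (fun i hi => by simp [hI i hi])
      (fun i hi => by simp [hc i hi])
  have hzero := eq_zero_of_restricted_near_isometry (N := N) hs hst hp0 hp1 hαpos
    (A ∘ₗ Matrix.toEuclideanLin.symm.toLinearMap ∘ₗ diagonalOperator u v)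
    (fun c I hcard hI hc => by
      rw [← hsq c I hI hc, ← mul_pow]
      exact pow_le_pow_left₀ (mul_nonneg hαpos.le (schattenNorm_nonneg _ _))
        (hα _ ((rank_diagonalOperator_le u v c I hI).trans hcard)) 2)
    (fun c I hcard hI hc => by
      rw [← hsq c I hI hc, ← mul_pow]
      exact pow_le_pow_left₀ (norm_nonneg _)
        (hβ _ ((rank_diagonalOperator_le u v c I hI).trans hcard)) 2)
    hγcond g hg0 hanti hgN
    (by
      change A (Matrix.toEuclideanLin.symm (diagonalOperator u v g)) = 0
      rw [hgH, map_sub, hfeas, sub_self])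
    hnull
  rw [← sub_eq_zero, ← hgH, show g = 0 from funext hzero, map_zero, map_zero]
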